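/- arXiv:2206.00173 — 8 statements merged into one kernel-verified Lean document; each statement's English description precedes it below -/
import Mathlib

section
/- Let A^1,…,A^ℓ,A^{ℓ+1} be partition matrices with m columns, let B = ∪_{n=1}^ℓ A^n (with β rows) and C = A^{ℓ+1} (with γ rows), and suppose that (B, C) satisfies the floret condition and that the stacked matrix consisting of B and C is well-connected. For u ∈ {1,…,β} and v ∈ {1,…,γ}, let ω_{uv} be the number of column indices j such that both the u-th row of B and the v-th row of C have a 1 in column j. Then there exist positive integers x_1,…,x_β, y_1,…,y_γ such that ω_{uv} = x_u y_v for all u, v with ω_{uv} ≠ 0. -/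
open Finset

namespace PM

variable {k : ℕ} {J : Type*} {I : Type*} [Fintype J] [DecidableEq J] [DecidableEq I]

/- A partition matrix (a 0/1 matrix in which every column sums to 1), with columns
indexed by `J` and rows indexed by `I`, is encoded by the map sending each column to the
unique row having a 1 in that column.  A multipartition matrix with `k` blocks is a
family `S : Fin k → J → I` of such maps (block `b` is the partition matrix whose row
through column `j` is `S b j`). -/

/-- Columns `j` and `j'` agree in the first `ℓ` blocks (blocks of index `< ℓ`). -/
def colEquiv (S : Fin k → J → I) (ℓ : ℕ) (j j' : J) : Prop :=
  ∀ b : Fin k, (b : ℕ) < ℓ → S b j = S b j'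

instance {S : Fin k → J → I} {ℓ : ℕ} {j j' : J} : Decidable (colEquiv S ℓ j j') :=
  inferInstanceAs (Decidable (∀ b : Fin k, (b : ℕ) < ℓ → S b j = S b j'))

/-- The column weight `c^ℓ_j` of column `j` in the stacked matrix of the first `ℓ` blocks. -/
def colWeight (S : Fin k → J → I) (ℓ : ℕ) (j : J) : ℕ :=
  (univ.filter fun j' => colEquiv S ℓ j j').card

/-- Well-connectedness: for every block `b` and all columns `j`, `j'` in the support of one
row of block `b`, `c^{b+1}_j / c^{b}_j = c^{b+1}_{j'} / c^{b}_{j'}` (cross-multiplied;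
here `b+1` counts blocks, so `colWeight S ((b:ℕ)+1)` includes block `b`, and the
condition is trivially true for the first block). -/
def WellConnected (S : Fin k → J → I) : Prop :=
  ∀ (b : Fin k) (j j' : J), S b j = S b j' →
    colWeight S ((b : ℕ) + 1) j * colWeight S (b : ℕ) j' =
      colWeight S ((b : ℕ) + 1) j' * colWeight S (b : ℕ) j

/-- The set of rows of block `b` connected to the row of `B_b = ∪_{n<b} A^n` supported
on column `j` (a floret of block `b`, represented by the column `j`). -/
def stage (S : Fin k → J → I) (b : Fin k) (j : J) : Finset I :=
  (univ.filter fun j' => colEquiv S (b : ℕ) j j').image (S b)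

/-- The pair `(∪_{n<b} A^n, A^b)` satisfies the floret condition: the sets of rows of the
block `b` connected to two rows of `B_b` are equal or disjoint. -/
def FloretCondition (S : Fin k → J → I) (b : Fin k) : Prop :=
  ∀ j j' : J, stage S b j = stage S b j' ∨ Disjoint (stage S b j) (stage S b j')

/-- The `i`-th row of block `b`, as a real vector. -/
def rowVec (S : Fin k → J → I) (b : Fin k) (i : I) : J → ℝ :=
  fun j => if S b j = i then 1 else 0

/-- `α^b_i · d`, the dot product of the `i`-th row of block `b` with `d`. -/
def rowDot (S : Fin k → J → I) (b : Fin k) (i : I) (d : J → ℝ) : ℝ :=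
  ∑ j, (if S b j = i then d j else 0)

/-- The set of rows of the stacked matrix consisting of the first `ℓ` blocks. -/
def prefixRows (S : Fin k → J → I) (ℓ : ℕ) : Set (J → ℝ) :=
  {v | ∃ (b : Fin k) (i : I), (b : ℕ) < ℓ ∧ v = rowVec S b i}

/-- The row of `D = B_b ∩ A^b` through column `j0` (the indicator vector of the columns
whose floret pair is that of `j0`). -/
def dRow (S : Fin k → J → I) (b : Fin k) (j0 : J) : J → ℝ :=
  fun j => if stage S b j = stage S b j0 then 1 else 0

/-- The generalized running intersection property: for every block `b ≥ 1` (paper: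
`ℓ + 1` with `1 ≤ ℓ ≤ k-1`), (1) the stacked matrix of `B_b = ∪_{n<b}A^n` and `A^b` is
well-connected, (2) the pair `(B_b, A^b)` satisfies the floret condition, and (3) every
row of `B_b ∩ A^b` lies in the real row span of the first `b` blocks. -/
def GRIP (S : Fin k → J → I) : Prop :=
  ∀ b : Fin k, 0 < (b : ℕ) →
    (∀ j j' : J, S b j = S b j' →
      colWeight S ((b : ℕ) + 1) j * colWeight S (b : ℕ) j' =
        colWeight S ((b : ℕ) + 1) j' * colWeight S (b : ℕ) j) ∧
    FloretCondition S b ∧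
    (∀ j0 : J, dRow S b j0 ∈ Submodule.span ℝ (prefixRows S (b : ℕ)))

/-- The level-`b` floret `F^b[i]` containing the `i`-th row of block `b`. -/
def floret (S : Fin k → J → I) (b : Fin k) (i : I) : Finset I :=
  (univ.filter fun j => S b j = i).biUnion fun j => stage S b j

/-- `Σ_{i' ∈ F^b[i]} α^b_{i'} · d`. -/
def floretSum (S : Fin k → J → I) (b : Fin k) (i : I) (d : J → ℝ) : ℝ :=
  ∑ j, (if S b j ∈ floret S b i then d j else 0)

/-- The likelihood `∏_j p_j^{d_j}` of data `d` at the point `p`. -/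
noncomputable def likelihood (d p : J → ℝ) : ℝ := ∏ j, p j ^ d j

/-- The log-linear (partition) model determined by a set of rows: probability
vectors with positive entries whose coordinatewise logarithm lies in the row span. -/
def inModel (Rows : Set (J → ℝ)) (p : J → ℝ) : Prop :=
  (∀ j, 0 < p j) ∧ (∑ j, p j) = 1 ∧
    (fun j => Real.log (p j)) ∈ Submodule.span ℝ Rows

/-- `p` is a maximum likelihood estimate for the data `d` in the model determined by
`Rows`: it maximizes the likelihood over the closure of the model. -/
def IsMLE (Rows : Set (J → ℝ)) (d p : J → ℝ) : Prop :=
  p ∈ closure {q | inModel Rows q} ∧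
    ∀ q ∈ closure {q | inModel Rows q}, likelihood d q ≤ likelihood d p

/-- The iterative proportional scaling iterates: `ips S d 0` is the uniform
distribution, and step `ℓ+1` rescales by the `ℓ`-th block (`q^{ℓ+1}_j =
q^ℓ_j ⬝ (α^ℓ_{S(ℓ,j)} · d) / (α^ℓ_{S(ℓ,j)} · q^ℓ)`). -/
noncomputable def ips (S : Fin k → J → I) (d : J → ℝ) : ℕ → J → ℝ
  | 0 => fun _ => (Fintype.card J : ℝ)⁻¹
  | ℓ + 1 => fun j =>
      if h : ℓ < k then
        ips S d ℓ j * rowDot S ⟨ℓ, h⟩ (S ⟨ℓ, h⟩ j) d /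
          rowDot S ⟨ℓ, h⟩ (S ⟨ℓ, h⟩ j) (ips S d ℓ)
      else ips S d ℓ j

end PM

namespace PM

theorem colEquiv_weight {k m : ℕ} (S : Fin k → Fin m → ℕ) (l : ℕ) (j j' : Fin m)
    (h : colEquiv S l j j') : 
    (univ.filter fun i => colEquiv S l j i) = (univ.filter fun i => colEquiv S l j' i) := by
  ext i
  simp only [mem_filter, mem_univ, true_and]
  exact ⟨fun h1 c hc => (h c hc).symm.trans (h1 c hc), fun h1 c hc => (h c hc).trans (h1 c hc)⟩

/-- The gcd of the weights `ω_{uv}` over the row `u` of `B` through column `j`. -/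
def xgcd {k m : ℕ} (S : Fin k → Fin m → ℕ) (b : Fin k) (j : Fin m) : ℕ :=
  (univ.filter fun i => colEquiv S (b : ℕ) j i).gcd fun i => colWeight S ((b : ℕ) + 1) i

theorem colWeight_pos {k m : ℕ} (S : Fin k → Fin m → ℕ) (l : ℕ) (j : Fin m) :
    0 < colWeight S l j :=
  card_pos.mpr ⟨j, mem_filter.mpr ⟨mem_univ _, fun _ _ => rfl⟩⟩

theorem xgcd_dvd {k m : ℕ} (S : Fin k → Fin m → ℕ) (b : Fin k) (j i : Fin m)
    (h : colEquiv S (b : ℕ) j i) : xgcd S b j ∣ colWeight S ((b : ℕ) + 1) i :=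
  Finset.gcd_dvd (by simpa using h)

theorem xgcd_mul_dvd {k m : ℕ} (S : Fin k → Fin m → ℕ) (b : Fin k)
    (hfc : FloretCondition S b)
    (hwc : ∀ j j' : Fin m, S b j = S b j' →
      colWeight S ((b : ℕ) + 1) j * colWeight S (b : ℕ) j' =
        colWeight S ((b : ℕ) + 1) j' * colWeight S (b : ℕ) j)
    (j j' : Fin m) (h : S b j = S b j') :
    xgcd S b j * colWeight S (b : ℕ) j' ∣ xgcd S b j' * colWeight S (b : ℕ) j := by
  have hst : stage S b j = stage S b j' := by
    refine (hfc j j').resolve_right fun hd => ?_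
    refine absurd ?_ (Finset.disjoint_left.mp hd (?_ : S b j ∈ stage S b j))
    · exact mem_image.mpr ⟨j', mem_filter.mpr ⟨mem_univ _, fun _ _ => rfl⟩, h.symm⟩
    · exact mem_image.mpr ⟨j, mem_filter.mpr ⟨mem_univ _, fun _ _ => rfl⟩, rfl⟩
  have e : xgcd S b j' * colWeight S (b : ℕ) j =
      (univ.filter fun i => colEquiv S (b : ℕ) j' i).gcd
        fun i => colWeight S ((b : ℕ) + 1) i * colWeight S (b : ℕ) j := by
    rw [Finset.gcd_mul_right]; simp [xgcd]
  rw [e]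
  refine Finset.dvd_gcd fun i' hi' => ?_
  have hmem : S b i' ∈ stage S b j := by
    rw [hst]; exact mem_image.mpr ⟨i', hi', rfl⟩
  obtain ⟨i, hi, hii⟩ := mem_image.mp hmem
  have hi2 : colEquiv S (b : ℕ) j i := by simpa using hi
  have hi2' : colEquiv S (b : ℕ) j' i' := by simpa using hi'
  have w1 : colWeight S (b : ℕ) j = colWeight S (b : ℕ) i :=
    congrArg card (colEquiv_weight S b j i hi2)
  have w2 : colWeight S (b : ℕ) j' = colWeight S (b : ℕ) i' :=
    congrArg card (colEquiv_weight S b j' i' hi2')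
  rw [w1, w2, ← hwc i i' hii]
  exact Nat.mul_dvd_mul_right (xgcd_dvd S b j i hi2) _

end PM

open Finset PM in
/-- Lemma 3.10.  Let `A^1,…,A^ℓ,A^{ℓ+1}` be partition matrices (the
blocks of the multipartition matrix `S`), let `B = ∪_{n=1}^ℓ A^n` and `C = A^{ℓ+1}`
(block `b`, `0 < b`), suppose `(B, C)` satisfies the floret condition and the stacked
matrix of `B` and `C` is well-connected.  For a row `u` of `B` (a `colEquiv`-class of
columns, represented by any of its columns `j`) and a row `v = S b j` of `C`, the number
`ω_{uv}` of columns supported on both rows is `colWeight S (b+1) j`.  Then there are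
positive integers `x_u` (encoded as a function of columns, constant on classes) and
`y_v` (a function of the row index) with `ω_{uv} = x_u * y_v` whenever `ω_{uv} ≠ 0`
(every nonzero `ω_{uv}` being realized by some column `j`). -/
theorem omega_factors {k m : ℕ} (S : Fin k → Fin m → ℕ) (b : Fin k) (hb : 0 < (b : ℕ))
    (hfc : FloretCondition S b)
    (hwc : ∀ j j' : Fin m, S b j = S b j' →
      colWeight S ((b : ℕ) + 1) j * colWeight S (b : ℕ) j' =
        colWeight S ((b : ℕ) + 1) j' * colWeight S (b : ℕ) j) :
    ∃ (x : Fin m → ℕ) (y : ℕ → ℕ),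
      (∀ j, 0 < x j) ∧ (∀ j, 0 < y (S b j)) ∧
      (∀ j j' : Fin m, colEquiv S (b : ℕ) j j' → x j = x j') ∧
      (∀ j : Fin m, colWeight S ((b : ℕ) + 1) j = x j * y (S b j)) := by
  classical
  have hrefl : ∀ j, colEquiv S (b : ℕ) j j := fun j c _ => rfl
  have hpos : ∀ j, 0 < xgcd S b j := fun j =>
    Nat.pos_of_dvd_of_pos (xgcd_dvd S b j j (hrefl j)) (colWeight_pos S _ j)
  have key : ∀ j j', S b j = S b j' →
      colWeight S ((b : ℕ) + 1) j / xgcd S b j = colWeight S ((b : ℕ) + 1) j' / xgcd S b j' := by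
    intro j j' h
    have h1 := Nat.dvd_antisymm (xgcd_mul_dvd S b hfc hwc j j' h)
      (xgcd_mul_dvd S b hfc hwc j' j h.symm)
    have h2 := hwc j j' h
    obtain ⟨p, hp⟩ := xgcd_dvd S b j j (hrefl j)
    obtain ⟨q, hq⟩ := xgcd_dvd S b j' j' (hrefl j')
    rw [hp, hq, Nat.mul_div_cancel_left _ (hpos j), Nat.mul_div_cancel_left _ (hpos j')]
    rw [hp, hq] at h2
    have h3 : (xgcd S b j' * colWeight S (b : ℕ) j) * p =
        (xgcd S b j' * colWeight S (b : ℕ) j) * q := by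
      rw [← h1]; rw [mul_right_comm, h2, mul_right_comm, h1]
    exact Nat.eq_of_mul_eq_mul_left (Nat.mul_pos (hpos j') (colWeight_pos S _ j)) h3
  let y : ℕ → ℕ := fun v => if h : ∃ j, S b j = v then
    colWeight S ((b : ℕ) + 1) h.choose / xgcd S b h.choose else 1
  have hy : ∀ j, y (S b j) = colWeight S ((b : ℕ) + 1) j / xgcd S b j := by
    intro j
    have h : ∃ j', S b j' = S b j := ⟨j, rfl⟩
    simp only [y, dif_pos h]
    exact key _ _ h.choose_spec
  refine ⟨xgcd S b, y, hpos, fun j => ?_, fun j j' h => ?_, fun j => ?_⟩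
  · rw [hy]
    exact Nat.div_pos (Nat.le_of_dvd (colWeight_pos S _ j) (xgcd_dvd S b j j (hrefl j))) (hpos j)
  · unfold xgcd
    rw [colEquiv_weight S b j j' h]
  · rw [hy, Nat.mul_div_cancel' (xgcd_dvd S b j j (hrefl j))]
end

section
/- Let B and C be partition matrices with the same number of columns satisfying the floret condition, and let D = B ∩ C. Then for each floret pair t, with F_t the corresponding floret of C, the t-th row of D equals the sum Σ_{α^C_v ∈ F_t} α^C_v of the rows of C in that floret. In particular, every row of D lies in the row span of C. -/
open Finset

/- Two partition matrices `B` and `C` with the same column set `Fin m` are encoded by maps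
`B C : Fin m → ℕ` sending each column to the unique row with a 1 in that column. -/

/-- The floret of `C` attached to the row of `B` supported on column `j`: the set of rows
of `C` connected to (i.e. whose support meets the support of) that row of `B`. -/
def cFloret {m : ℕ} (B C : Fin m → ℕ) (j : Fin m) : Finset ℕ :=
  (univ.filter fun j' => B j' = B j).image C

/-- The `i`-th row of `C` as a real vector. -/
def cRowVec {m : ℕ} (C : Fin m → ℕ) (i : ℕ) : Fin m → ℝ :=
  fun j => if C j = i then 1 else 0

/-- The row of `D = B ∩ C` through column `j0`: the indicator vector of the columns
whose supporting rows of `B` and `C` belong to the same floret pair as those of `j0`. -/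
def dRow2 {m : ℕ} (B C : Fin m → ℕ) (j0 : Fin m) : Fin m → ℝ :=
  fun j => if cFloret B C j = cFloret B C j0 then 1 else 0

/-- Let `B` and `C` be partition matrices with the same number of
columns satisfying the floret condition, and let `D = B ∩ C`.  Then each row of `D`
(the row of the floret pair of a column `j0`) equals the sum of the rows of `C` lying in
the corresponding floret of `C`; in particular, every row of `D` lies in the real row
span of `C`. -/
theorem dRow_eq_floret_sum {m : ℕ} (B C : Fin m → ℕ)
    (hfc : ∀ j j' : Fin m,
      cFloret B C j = cFloret B C j' ∨ Disjoint (cFloret B C j) (cFloret B C j')) :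
    ∀ j0 : Fin m,
      (dRow2 B C j0 = fun j => ∑ i ∈ cFloret B C j0, cRowVec C i j) ∧
      dRow2 B C j0 ∈ Submodule.span ℝ {v : Fin m → ℝ | ∃ i : ℕ, v = cRowVec C i} := by
  intro j0
  have hself : ∀ j : Fin m, C j ∈ cFloret B C j := by
    intro j
    unfold cFloret
    exact Finset.mem_image.2 ⟨j, by simp, rfl⟩
  have key : dRow2 B C j0 = fun j => ∑ i ∈ cFloret B C j0, cRowVec C i j := by
    funext j
    simp only [dRow2, cRowVec]
    rw [Finset.sum_ite_eq]
    have hiff : cFloret B C j = cFloret B C j0 ↔ C j ∈ cFloret B C j0 := by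
      constructor
      · intro h
        rw [← h]
        exact hself j
      · intro h
        rcases hfc j j0 with h1 | h1
        · exact h1
        · exact absurd h (Finset.disjoint_left.1 h1 (hself j))
    by_cases h : C j ∈ cFloret B C j0
    · rw [if_pos h, if_pos (hiff.2 h)]
    · rw [if_neg h, if_neg (fun h' => h (hiff.1 h'))]
  refine ⟨key, ?_⟩
  have key2 : dRow2 B C j0 = ∑ i ∈ cFloret B C j0, cRowVec C i := by
    rw [key]
    funext j
    rw [Finset.sum_apply]
  rw [key2]
  exact Submodule.sum_mem _ fun i _ => Submodule.subset_span ⟨i, rfl⟩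
end

section
/- Let A^{1,…,ℓ+1} be a multipartition matrix satisfying the GRIP, let B_ℓ = ∪_{n=1}^ℓ A^n and D = B_ℓ ∩ A^{ℓ+1}. Let Ā^{1,…,ℓ} be any compression of A^{1,…,ℓ} (a matrix with the same set of distinct columns, containing at most as many copies of each column), let D̄ be obtained from D by deleting the same columns, and similarly let Ā^{ℓ+1} be any compression of A^{ℓ+1} with D̄′ the corresponding compression of D. Then the toric ideals I(Ā^{1,…,ℓ}) and I(Ā^{ℓ+1}) are homogeneous with respect to the multigrading assigning to the variable of each column the corresponding column of D̄ (respectively D̄′); equivalently, for all nonnegative integer vectors u, v with Ā^{1,…,ℓ} u = Ā^{1,…,ℓ} v one has D̄ u = D̄ v, and for all nonnegative integer vectors u, v with Ā^{ℓ+1} u = Ā^{ℓ+1} v one has D̄′ u = D̄′ v. -/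
open Finset

open Finset PM in
/-- Proposition 3.14.  Let `A^{1,…,ℓ+1}` (blocks of `S`, with
`C = A^{ℓ+1}` the block `b`, `0 < b`) satisfy the GRIP, let `B_ℓ = ∪_{n=1}^ℓ A^n` and
`D = B_ℓ ∩ A^{ℓ+1}`.  Let `Ā^{1,…,ℓ}` be any compression of `A^{1,…,ℓ}` (columns indexed
by `Fin nx`, the column `t` being the column `ρ t` of `A^{1,…,ℓ}`; a compression has the
same set of distinct columns, with at most as many copies of each), and let `D̄` be
obtained from `D` by deleting the same columns; similarly let `Ā^{ℓ+1}` (via `σ`) be any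
compression of `A^{ℓ+1}` with `D̄′` the corresponding compression of `D`.  Then the toric
ideals `I(Ā^{1,…,ℓ})` and `I(Ā^{ℓ+1})` are homogeneous with respect to the multigrading
assigning to each column-variable the corresponding column of `D̄` (resp. `D̄′`):
for all nonnegative integer vectors `u`, `v` with `Ā^{1,…,ℓ} u = Ā^{1,…,ℓ} v` one has
`D̄ u = D̄ v` (the column of `D` through `j` being the indicator of the floret pair
`stage S b j`, so `D̄ u = D̄ v` reads: for every floret pair, represented by a column
`j0`, the `u`- and `v`-weighted counts agree), and likewise for `Ā^{ℓ+1}` and `D̄′`. -/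
theorem compressions_multihomogeneous {k m : ℕ} (S : Fin k → Fin m → ℕ)
    (hgrip : GRIP S) (b : Fin k) (hb : 0 < (b : ℕ))
    {nx ny : ℕ} (ρ : Fin nx → Fin m) (σ : Fin ny → Fin m)
    (hρle : ∀ j : Fin m,
      (univ.filter fun t => colEquiv S (b : ℕ) (ρ t) j).card ≤ colWeight S (b : ℕ) j)
    (hρall : ∀ j : Fin m, ∃ t, colEquiv S (b : ℕ) (ρ t) j)
    (hσle : ∀ j : Fin m,
      (univ.filter fun t => S b (σ t) = S b j).card ≤
        (univ.filter fun j' => S b j' = S b j).card)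
    (hσall : ∀ j : Fin m, ∃ t, S b (σ t) = S b j) :
    (∀ u v : Fin nx → ℕ,
      (∀ (b' : Fin k) (i : ℕ), (b' : ℕ) < (b : ℕ) →
        ∑ t, u t * (if S b' (ρ t) = i then 1 else 0) =
          ∑ t, v t * (if S b' (ρ t) = i then 1 else 0)) →
      ∀ j0 : Fin m,
        ∑ t, u t * (if stage S b (ρ t) = stage S b j0 then 1 else 0) =
          ∑ t, v t * (if stage S b (ρ t) = stage S b j0 then 1 else 0)) ∧
    (∀ u v : Fin ny → ℕ,
      (∀ i : ℕ,
        ∑ t, u t * (if S b (σ t) = i then 1 else 0) =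
          ∑ t, v t * (if S b (σ t) = i then 1 else 0)) →
      ∀ j0 : Fin m,
        ∑ t, u t * (if stage S b (σ t) = stage S b j0 then 1 else 0) =
          ∑ t, v t * (if stage S b (σ t) = stage S b j0 then 1 else 0)) := by
  obtain ⟨-, hfl, hspan⟩ := hgrip b hb
  refine ⟨?_, ?_⟩
  · intro u v huv j0
    have key : ∀ x ∈ Submodule.span ℝ (prefixRows S (b : ℕ)),
        ∑ t, (u t : ℝ) * x (ρ t) = ∑ t, (v t : ℝ) * x (ρ t) := by
      intro x hx
      induction hx using Submodule.span_induction with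
      | mem x hx =>
        obtain ⟨b', i, hb', rfl⟩ := hx
        have h := huv b' i hb'
        simp only [rowVec]
        exact_mod_cast h
      | zero => simp
      | add x y _ _ hx hy =>
        simp only [Pi.add_apply, mul_add, Finset.sum_add_distrib, hx, hy]
      | smul a x _ hx =>
        simp only [Pi.smul_apply, smul_eq_mul, mul_left_comm _ a, ← Finset.mul_sum, hx]
    have h := key _ (hspan j0)
    simp only [dRow] at h
    exact_mod_cast h
  · intro u v huv j0
    have hmem : ∀ j, S b j ∈ stage S b j := by
      intro j
      refine Finset.mem_image.2 ⟨j, ?_, rfl⟩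
      simp [colEquiv]
    have hst : ∀ j j', S b j = S b j' → stage S b j = stage S b j' := by
      intro j j' h
      rcases hfl j j' with h1 | h1
      · exact h1
      · exact absurd (h ▸ hmem j') (Finset.disjoint_left.1 h1 (hmem j))
    have hind : ∀ t, (if stage S b (σ t) = stage S b j0 then 1 else 0 : ℕ) =
        ∑ i ∈ (univ.filter fun j => stage S b j = stage S b j0).image (S b),
          (if S b (σ t) = i then 1 else 0) := by
      intro t
      rw [Finset.sum_ite_eq]
      refine if_congr ?_ rfl rfl
      constructor
      · intro h
        exact Finset.mem_image.2 ⟨σ t, by simpa using h, rfl⟩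
      · intro h
        obtain ⟨j, hj, hjt⟩ := Finset.mem_image.1 h
        rw [← hst j (σ t) hjt]
        simpa using hj
    simp only [hind, Finset.mul_sum]
    rw [Finset.sum_comm, Finset.sum_comm (s := univ)]
    exact Finset.sum_congr rfl fun i _ => huv i
end

section
/- Suppose the multipartition matrix A^{1,…,ℓ+1} satisfies the GRIP. With B = ∪_{n=1}^ℓ A^n (β rows), C = A^{ℓ+1} (γ rows), ω_{uv} the number of columns of A^{1,…,ℓ+1} whose B-row index is u and C-row index is v, positive integers x_u, y_v with ω_{uv} = x_u y_v whenever ω_{uv} ≠ 0, and compressions Ã^{1,…,ℓ} (containing exactly x_u copies of the distinct column of A^{1,…,ℓ} labeled u, columns indexed by pairs (u, s′) with 0 ≤ s′ ≤ x_u − 1) and Ã^{ℓ+1} (containing exactly y_v copies of the v-th standard basis vector of ℤ^γ, columns indexed by pairs (v, s″) with 0 ≤ s″ ≤ y_v − 1): the toric ideal I(A^{1,…,ℓ+1}) equals the kernel of the ℂ-algebra homomorphism ψ : ℂ[z_{(u,v,s)} : ω_{uv} ≠ 0, 0 ≤ s ≤ ω_{uv} − 1] → (ℂ[x_{(u,s′)}]/I(Ã^{1,…,ℓ}))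 ⊗_ℂ (ℂ[y_{(v,s″)}]/I(Ã^{ℓ+1})) defined by z_{(u,v,s)} ↦ x̄_{(u,s′)} ⊗ ȳ_{(v,s″)}, where s = s′·y_v + s″ with 0 ≤ s″ ≤ y_v − 1, the columns of A^{1,…,ℓ+1} being indexed by the triples (u, v, s). That is, I(A^{1,…,ℓ+1}) is the toric fiber product of I(Ã^{1,…,ℓ}) and I(Ã^{ℓ+1}). -/
open Finset

open Finset TensorProduct

/-- The toric ideal of an integer (here: natural-number) matrix `M` whose columns are
indexed by `J` and rows by `R`: the ideal of `ℂ[p_j : j ∈ J]` generated by all binomials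
`p^u − p^v` with `u, v ∈ ℕ^J` and `M u = M v`. -/
noncomputable def toricIdeal {J : Type*} [Fintype J] {R : Type*} (M : J → R → ℕ) :
    Ideal (MvPolynomial J ℂ) :=
  Ideal.span {f | ∃ u v : J → ℕ,
    (∀ r : R, ∑ j, u j * M j r = ∑ j, v j * M j r) ∧
    f = MvPolynomial.monomial (Finsupp.equivFunOnFinite.symm u) 1 -
        MvPolynomial.monomial (Finsupp.equivFunOnFinite.symm v) 1}

/-- The matrix of the first `ℓ` blocks of a multipartition matrix `S`, with rows indexed
by pairs (block, row index). -/
def stackMat {k m : ℕ} (S : Fin k → Fin m → ℕ) (ℓ : ℕ) : Fin m → (Fin k × ℕ) → ℕ :=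
  fun j r => if (r.1 : ℕ) < ℓ ∧ S r.1 j = r.2 then 1 else 0

/-- The matrix of the compression `Ã^{1,…,ℓ}` of the first `b` blocks whose `t`-th column
is the column `ρ t`. -/
def compPrefixMat {k m : ℕ} (S : Fin k → Fin m → ℕ) (b : Fin k) {nx : ℕ}
    (ρ : Fin nx → Fin m) : Fin nx → (Fin k × ℕ) → ℕ :=
  fun t r => if (r.1 : ℕ) < (b : ℕ) ∧ S r.1 (ρ t) = r.2 then 1 else 0

/-- The matrix of the compression `Ã^{ℓ+1}` of block `b` whose `t`-th column is the
standard basis vector of the row `S b (σ t)`. -/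
def compBlockMat {k m : ℕ} (S : Fin k → Fin m → ℕ) (b : Fin k) {ny : ℕ}
    (σ : Fin ny → Fin m) : Fin ny → ℕ → ℕ :=
  fun t i => if S b (σ t) = i then 1 else 0

/-- The toric fiber product map `ψ` sending `z_j  = z_{(u,v,s)}` to
`x̄_{(u,s′)} ⊗ ȳ_{(v,s″)}`, where `π` matches each column `j` of `A^{1,…,ℓ+1}` with a
pair of columns of the compressions. -/
noncomputable def tfpMap {k m : ℕ} (S : Fin k → Fin m → ℕ) (b : Fin k) {nx ny : ℕ}
    (ρ : Fin nx → Fin m) (σ : Fin ny → Fin m) (π : Fin m → Fin nx × Fin ny) :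
    MvPolynomial (Fin m) ℂ →ₐ[ℂ]
      ((MvPolynomial (Fin nx) ℂ ⧸ toricIdeal (compPrefixMat S b ρ)) ⊗[ℂ]
        (MvPolynomial (Fin ny) ℂ ⧸ toricIdeal (compBlockMat S b σ))) :=
  MvPolynomial.aeval fun j =>
    (Ideal.Quotient.mk (toricIdeal (compPrefixMat S b ρ)) (MvPolynomial.X (π j).1)) ⊗ₜ[ℂ]
      (Ideal.Quotient.mk (toricIdeal (compBlockMat S b σ)) (MvPolynomial.X (π j).2))

section Helpers

open MvPolynomial

lemma tfp_monomial_eq {J : Type*} [Fintype J] (u : J → ℕ) :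
    (MvPolynomial.monomial (Finsupp.equivFunOnFinite.symm u) (1 : ℂ)) =
      ∏ j, (X j : MvPolynomial J ℂ) ^ u j := by
  rw [MvPolynomial.monomial_eq, Finsupp.prod_fintype]
  · simp
  · simp

/-- The monomial map sending `p_j` to the element `g j` of a monoid algebra. -/
noncomputable def tfpMono {J G : Type*} [AddCommMonoid G] (g : J → G) :
    MvPolynomial J ℂ →ₐ[ℂ] AddMonoidAlgebra ℂ G :=
  MvPolynomial.aeval fun j => AddMonoidAlgebra.of ℂ G (Multiplicative.ofAdd (g j))

lemma tfpMono_monomial {J G : Type*} [Fintype J] [AddCommMonoid G] (g : J → G) (u : J → ℕ) :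
    tfpMono g (∏ j, (X j : MvPolynomial J ℂ) ^ u j) =
      AddMonoidAlgebra.of ℂ G (Multiplicative.ofAdd (∑ j, u j • g j)) := by
  simp only [tfpMono, map_prod, map_pow, aeval_X, ofAdd_sum, ofAdd_nsmul]

lemma tfpMono_kill {J R G : Type*} [Fintype J] [AddCommMonoid G] (M : J → R → ℕ)
    (e : (R → ℕ) →+ G) (f : MvPolynomial J ℂ) (hf : f ∈ toricIdeal M) :
    tfpMono (fun j => e (M j)) f = 0 := by
  have : toricIdeal M ≤ RingHom.ker (tfpMono (fun j => e (M j))) := by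
    refine Ideal.span_le.2 ?_
    rintro _ ⟨u, v, h, rfl⟩
    rw [SetLike.mem_coe, RingHom.mem_ker, map_sub, tfp_monomial_eq, tfp_monomial_eq,
      tfpMono_monomial, tfpMono_monomial, sub_eq_zero]
    congr 2
    simp only [← map_nsmul, ← map_sum]
    congr 1
    ext r
    simpa using h r
  exact this hf

lemma tfp_mem_of_mono {J G : Type*} [Fintype J] [AddCommMonoid G] (g : J → G)
    (I : Ideal (MvPolynomial J ℂ))
    (hI : ∀ u v : J → ℕ, ∑ j, u j • g j = ∑ j, v j • g j →
      (∏ j, (X j : MvPolynomial J ℂ) ^ u j) - ∏ j, (X j : MvPolynomial J ℂ) ^ v j ∈ I)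
    (f : MvPolynomial J ℂ) (hf : tfpMono g f = 0) : f ∈ I := by
  classical
  let q : G → MvPolynomial J ℂ ⧸ I := fun a =>
    if h : ∃ u : J → ℕ, ∑ j, u j • g j = a then
      Ideal.Quotient.mk I (∏ j, (X j : MvPolynomial J ℂ) ^ (h.choose j)) else 0
  have hq : ∀ u : J → ℕ, q (∑ j, u j • g j) =
      Ideal.Quotient.mk I (∏ j, (X j : MvPolynomial J ℂ) ^ u j) := by
    intro u
    have h : ∃ u' : J → ℕ, ∑ j, u' j • g j = ∑ j, u j • g j := ⟨u, rfl⟩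
    simp only [q]
    rw [dif_pos h, Ideal.Quotient.eq]
    exact hI _ _ h.choose_spec
  let L : AddMonoidAlgebra ℂ G →ₗ[ℂ] MvPolynomial J ℂ ⧸ I :=
    (Finsupp.linearCombination ℂ q) ∘ₗ (AddMonoidAlgebra.coeffLinearEquiv ℂ).toLinearMap
  have hL : L ∘ₗ (tfpMono g).toLinearMap = (Ideal.Quotient.mkₐ ℂ I).toLinearMap := by
    ext u
    obtain ⟨u, rfl⟩ := Finsupp.equivFunOnFinite.symm.surjective u
    change L (tfpMono g (monomial (Finsupp.equivFunOnFinite.symm u) 1)) =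
      Ideal.Quotient.mkₐ ℂ I (monomial (Finsupp.equivFunOnFinite.symm u) 1)
    rw [tfp_monomial_eq, tfpMono_monomial]
    simp [L, hq]
  have := congrArg (fun l => l f) hL
  simp only [LinearMap.comp_apply, AlgHom.toLinearMap_apply, hf, map_zero] at this
  exact Ideal.Quotient.eq_zero_iff_mem.1 this.symm

lemma tfp_sum_comp {J T : Type*} [Fintype J] [Fintype T] [DecidableEq T] (p : J → T)
    (u : J → ℕ) (w : T → ℕ) :
    ∑ t, (∑ j, if p j = t then u j else 0) * w t = ∑ j, u j * w (p j) := by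
  simp only [Finset.sum_mul, ite_mul, zero_mul]
  rw [Finset.sum_comm]
  simp

lemma tfp_prod_comp {J T A : Type*} [Fintype J] [Fintype T] [DecidableEq T] [CommMonoid A]
    (p : J → T) (u : J → ℕ) (w : T → A) :
    ∏ j, w (p j) ^ u j = ∏ t, w t ^ (∑ j, if p j = t then u j else 0) := by
  simp only [← Finset.prod_pow_eq_pow_sum, pow_ite, pow_zero]
  rw [Finset.prod_comm]
  simp

lemma tfp_mk_eq {J T R : Type*} [Fintype J] [Fintype T] (M : T → R → ℕ) (p : J → T)
    (u v : J → ℕ) (h : ∀ r, ∑ j, u j * M (p j) r = ∑ j, v j * M (p j) r) :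
    ∏ j, Ideal.Quotient.mk (toricIdeal M) (X (p j)) ^ u j =
      ∏ j, Ideal.Quotient.mk (toricIdeal M) (X (p j)) ^ v j := by
  classical
  rw [tfp_prod_comp p u (fun t => Ideal.Quotient.mk (toricIdeal M) (X t)),
    tfp_prod_comp p v (fun t => Ideal.Quotient.mk (toricIdeal M) (X t))]
  simp only [← map_pow, ← map_prod]
  rw [Ideal.Quotient.eq]
  refine Ideal.subset_span ⟨fun t => ∑ j, if p j = t then u j else 0,
    fun t => ∑ j, if p j = t then v j else 0, ?_, by rw [tfp_monomial_eq, tfp_monomial_eq]⟩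
  intro r
  rw [tfp_sum_comp p u (fun t => M t r), tfp_sum_comp p v (fun t => M t r), h]

lemma tfp_tmul_prod {J A B : Type*} [Fintype J] [CommRing A] [CommRing B] [Algebra ℂ A]
    [Algebra ℂ B] (a : J → A) (c : J → B) (u : J → ℕ) :
    ∏ j, (a j ⊗ₜ[ℂ] c j) ^ u j = (∏ j, a j ^ u j) ⊗ₜ[ℂ] (∏ j, c j ^ u j) := by
  classical
  simp only [Algebra.TensorProduct.tmul_pow]
  induction (Finset.univ : Finset J) using Finset.induction_on with
  | empty => simp [Algebra.TensorProduct.one_def]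
  | insert i s hi ih => simp [Finset.prod_insert hi, ih]

lemma tfp_aeval_tmul {J A B : Type*} [Fintype J] [CommRing A] [CommRing B] [Algebra ℂ A]
    [Algebra ℂ B] (a : J → A) (c : J → B) (u : J → ℕ) :
    MvPolynomial.aeval (fun j => a j ⊗ₜ[ℂ] c j) (∏ j, (X j : MvPolynomial J ℂ) ^ u j) =
      (∏ j, a j ^ u j) ⊗ₜ[ℂ] (∏ j, c j ^ u j) := by
  rw [← tfp_tmul_prod, map_prod]
  simp only [map_pow, aeval_X]

end Helpers

open Finset PM in
/-- Theorem 3.11.  Suppose the multipartition matrix `A^{1,…,ℓ+1}`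
(blocks of `S`, with `C = A^{ℓ+1}` the block `b`, `0 < b`) satisfies the GRIP.  With
`B = ∪_{n=1}^ℓ A^n` (whose rows are the `colEquiv`-classes of columns), `ω_{uv}` the
number of columns of `A^{1,…,ℓ+1}` with `B`-row `u` and `C`-row `v` (so
`ω_{uv} = colWeight S (b+1) j` for a representative column `j`), positive integers
`x_u` (a function of columns constant on classes) and `y_v` (a function of row indices)
with `ω_{uv} = x_u * y_v` whenever `ω_{uv} ≠ 0`, a compression `Ã^{1,…,ℓ}` containing
exactly `x_u` copies of the distinct column labeled `u` (columns `ρ t`, `t : Fin nx`),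
a compression `Ã^{ℓ+1}` containing exactly `y_v` copies of the `v`-th standard basis
vector (columns `σ t`, `t : Fin ny`), and the matching `π` of the columns `(u,v,s)` of
`A^{1,…,ℓ+1}` with the compatible pairs of compression columns (injective, preserving
the `B`-class and the `C`-row): the toric ideal `I(A^{1,…,ℓ+1})` equals the kernel of
the toric fiber product map `ψ = tfpMap S b ρ σ π` into
`(ℂ[x]/I(Ã^{1,…,ℓ})) ⊗_ℂ (ℂ[y]/I(Ã^{ℓ+1}))`; that is, `I(A^{1,…,ℓ+1})` is the toric
fiber product of `I(Ã^{1,…,ℓ})` and `I(Ã^{ℓ+1})`. -/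
theorem toricIdeal_eq_tfp {k m : ℕ} (S : Fin k → Fin m → ℕ) (hgrip : GRIP S)
    (b : Fin k) (hb : 0 < (b : ℕ))
    (x : Fin m → ℕ) (y : ℕ → ℕ)
    (hxconst : ∀ j j' : Fin m, colEquiv S (b : ℕ) j j' → x j = x j')
    (hxpos : ∀ j, 0 < x j) (hypos : ∀ j, 0 < y (S b j))
    (hfact : ∀ j : Fin m, colWeight S ((b : ℕ) + 1) j = x j * y (S b j))
    {nx ny : ℕ} (ρ : Fin nx → Fin m) (σ : Fin ny → Fin m)
    (hρ : ∀ j : Fin m, (univ.filter fun t => colEquiv S (b : ℕ) (ρ t) j).card = x j)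
    (hσ : ∀ j : Fin m, (univ.filter fun t => S b (σ t) = S b j).card = y (S b j))
    (π : Fin m → Fin nx × Fin ny)
    (hπ1 : ∀ j, colEquiv S (b : ℕ) (ρ (π j).1) j)
    (hπ2 : ∀ j, S b (σ (π j).2) = S b j)
    (hπinj : Function.Injective π) :
    toricIdeal (stackMat S ((b : ℕ) + 1)) =
      RingHom.ker (tfpMap S b ρ σ π).toRingHom := by
  classical
  have hM1 : ∀ j r, compPrefixMat S b ρ (π j).1 r = stackMat S (b : ℕ) j r := by
    intro j r
    unfold compPrefixMat stackMat
    by_cases h : (r.1 : ℕ) < b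
    · rw [hπ1 j r.1 h]
    · simp [h]
  have hM2 : ∀ j i, compBlockMat S b σ (π j).2 i = if S b j = i then 1 else 0 := by
    intro j i
    unfold compBlockMat
    rw [hπ2]
  -- equality of degrees for the stacked matrix
  have hdeg : ∀ u v : Fin m → ℕ,
      (∀ r, ∑ j, u j * stackMat S ((b : ℕ) + 1) j r =
        ∑ j, v j * stackMat S ((b : ℕ) + 1) j r) ↔
      ((∀ r, ∑ j, u j * compPrefixMat S b ρ (π j).1 r =
          ∑ j, v j * compPrefixMat S b ρ (π j).1 r) ∧
        (∀ i, ∑ j, u j * compBlockMat S b σ (π j).2 i =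
          ∑ j, v j * compBlockMat S b σ (π j).2 i)) := by
    intro u v
    simp only [hM1, hM2]
    constructor
    · intro h
      refine ⟨fun r => ?_, fun i => ?_⟩
      · by_cases hr : (r.1 : ℕ) < b
        · have := h r
          simpa [stackMat, hr, Nat.lt_succ_of_lt hr] using this
        · simp [stackMat, hr]
      · have := h (b, i)
        simpa [stackMat] using this
    · rintro ⟨h1, h2⟩ r
      by_cases hr : (r.1 : ℕ) < b
      · have := h1 r
        simpa [stackMat, hr, Nat.lt_succ_of_lt hr] using this
      · by_cases hr' : r.1 = b
        · have := h2 r.2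
          simpa [stackMat, hr'] using this
        · have : ¬ (r.1 : ℕ) < (b : ℕ) + 1 := by
            intro h
            exact hr' (Fin.ext (by omega))
          simp [stackMat, this]
  apply le_antisymm
  · refine Ideal.span_le.2 ?_
    rintro _ ⟨u, v, h, rfl⟩
    obtain ⟨h1, h2⟩ := (hdeg u v).1 h
    rw [SetLike.mem_coe, RingHom.mem_ker, map_sub, tfp_monomial_eq, tfp_monomial_eq, sub_eq_zero]
    change tfpMap S b ρ σ π _ = tfpMap S b ρ σ π _
    unfold tfpMap
    rw [tfp_aeval_tmul, tfp_aeval_tmul,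
      tfp_mk_eq (compPrefixMat S b ρ) (fun j => (π j).1) u v h1,
      tfp_mk_eq (compBlockMat S b σ) (fun j => (π j).2) u v h2]
  · intro f hf
    replace hf : tfpMap S b ρ σ π f = 0 := hf
    let e1 : (Fin k × ℕ → ℕ) →+ (Fin k × ℕ → ℕ) × (ℕ → ℕ) := AddMonoidHom.inl _ _
    let e2 : (ℕ → ℕ) →+ (Fin k × ℕ → ℕ) × (ℕ → ℕ) := AddMonoidHom.inr _ _
    let φ1 := Ideal.Quotient.liftₐ (toricIdeal (compPrefixMat S b ρ))
      (tfpMono fun t => e1 (compPrefixMat S b ρ t)) (tfpMono_kill _ e1)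
    let φ2 := Ideal.Quotient.liftₐ (toricIdeal (compBlockMat S b σ))
      (tfpMono fun t => e2 (compBlockMat S b σ t)) (tfpMono_kill _ e2)
    let g : Fin m → (Fin k × ℕ → ℕ) × (ℕ → ℕ) := fun j =>
      (compPrefixMat S b ρ (π j).1, compBlockMat S b σ (π j).2)
    have hcomp : (Algebra.TensorProduct.productMap φ1 φ2).comp (tfpMap S b ρ σ π) =
        tfpMono g := by
      apply MvPolynomial.algHom_ext
      intro j
      have a1 : φ1 (Ideal.Quotient.mk _ (MvPolynomial.X (π j).1)) =
          AddMonoidAlgebra.of ℂ _ (Multiplicative.ofAdd (e1 (compPrefixMat S b ρ (π j).1))) := by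
        change tfpMono _ (MvPolynomial.X _) = _
        simp [tfpMono]
      have a2 : φ2 (Ideal.Quotient.mk _ (MvPolynomial.X (π j).2)) =
          AddMonoidAlgebra.of ℂ _ (Multiplicative.ofAdd (e2 (compBlockMat S b σ (π j).2))) := by
        change tfpMono _ (MvPolynomial.X _) = _
        simp [tfpMono]
      rw [AlgHom.comp_apply, tfpMap, MvPolynomial.aeval_X,
        Algebra.TensorProduct.productMap_apply_tmul, a1, a2, ← map_mul, ← ofAdd_add, tfpMono,
        MvPolynomial.aeval_X]
      simp [e1, e2, g]
    refine tfp_mem_of_mono g _ ?_ f ?_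
    · intro u v h
      refine Ideal.subset_span ⟨u, v, (hdeg u v).2 ⟨?_, ?_⟩,
        by rw [tfp_monomial_eq, tfp_monomial_eq]⟩
      · intro r
        have := congrFun (congrArg Prod.fst h) r
        simpa [g, Prod.fst_sum] using this
      · intro r
        have := congrFun (congrArg Prod.snd h) r
        simpa [g, Prod.snd_sum] using this
    · rw [← hcomp, AlgHom.comp_apply, hf, map_zero]
end

section
/- Let A be a multipartition matrix with k blocks satisfying the GRIP and let d be a normalized data vector with positive entries. Then for every row α^k_i of the last block A^k: Σ_{j ∈ I^k_i} (1/c^{k−1}_j) · ∏_{ℓ=1}^{k−1} (α^ℓ_{S(ℓ,j)} · d) / (Σ_{α^ℓ_{i′} ∈ F^ℓ[S(ℓ,j)]} α^ℓ_{i′} · d) = C^k_i · Σ_{α^k_{i′} ∈ F^k[i]} α^k_{i′} · d. -/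
open Finset

namespace PM

noncomputable def pv {k m : ℕ} (S : Fin k → Fin m → ℕ) (d : Fin m → ℝ) (l : ℕ) (j : Fin m) : ℝ :=
  (colWeight S l j : ℝ)⁻¹ *
    ∏ b ∈ univ.filter (fun b : Fin k => (b : ℕ) < l),
      rowDot S b (S b j) d / floretSum S b (S b j) d

section
variable {k m : ℕ} {S : Fin k → Fin m → ℕ}

lemma ce_refl (l : ℕ) (j : Fin m) : colEquiv S l j j := fun _ _ => rfl

lemma ce_symm {l : ℕ} {j j' : Fin m} (h : colEquiv S l j j') : colEquiv S l j' j :=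
  fun b hb => (h b hb).symm

lemma ce_trans {l : ℕ} {j j' j'' : Fin m} (h : colEquiv S l j j') (h' : colEquiv S l j' j'') :
    colEquiv S l j j'' := fun b hb => (h b hb).trans (h' b hb)

lemma ce_iff {l : ℕ} {j j' : Fin m} (h : colEquiv S l j j') (x : Fin m) :
    colEquiv S l j x ↔ colEquiv S l j' x :=
  ⟨fun hx => ce_trans (ce_symm h) hx, fun hx => ce_trans h hx⟩

lemma ce_succ {b : Fin k} {j j' : Fin m} :
    colEquiv S ((b : ℕ) + 1) j j' ↔ colEquiv S (b : ℕ) j j' ∧ S b j = S b j' := by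
  constructor
  · intro h
    exact ⟨fun c hc => h c (by omega), h b (by omega)⟩
  · rintro ⟨h, h'⟩ c hc
    rcases Nat.lt_succ_iff_lt_or_eq.1 hc with h1 | h1
    · exact h c h1
    · have : c = b := Fin.ext h1
      subst this; exact h'

lemma cw_congr {l : ℕ} {j j' : Fin m} (h : colEquiv S l j j') :
    colWeight S l j = colWeight S l j' := by
  unfold colWeight
  congr 1
  ext x
  simp [ce_iff h]

lemma cw_pos (l : ℕ) (j : Fin m) : 0 < colWeight S l j :=
  Finset.card_pos.2 ⟨j, by simp [ce_refl]⟩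

lemma cw_ne (l : ℕ) (j : Fin m) : (colWeight S l j : ℝ) ≠ 0 := by
  exact_mod_cast (cw_pos l j).ne'

lemma stage_congr {b : Fin k} {j j' : Fin m} (h : colEquiv S (b : ℕ) j j') :
    stage S b j = stage S b j' := by
  unfold stage
  congr 1
  ext x
  simp [ce_iff h]

lemma mem_stage_self (b : Fin k) (j : Fin m) : S b j ∈ stage S b j := by
  unfold stage
  exact Finset.mem_image_of_mem _ (by simp [ce_refl])

lemma floretCond (hg : GRIP S) (b : Fin k) : FloretCondition S b := by
  rcases Nat.eq_zero_or_pos (b : ℕ) with h | h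
  · intro j j'
    left
    apply stage_congr
    intro c hc
    omega
  · exact (hg b h).2.1

lemma wellConn (hg : GRIP S) (b : Fin k) (j j' : Fin m) (hj : S b j = S b j') :
    colWeight S ((b : ℕ) + 1) j * colWeight S (b : ℕ) j' =
        colWeight S ((b : ℕ) + 1) j' * colWeight S (b : ℕ) j := by
  rcases Nat.eq_zero_or_pos (b : ℕ) with h | h
  · have h0 : colEquiv S (b : ℕ) j j' := fun c hc => by omega
    rw [cw_congr h0, cw_congr (ce_succ.2 ⟨h0, hj⟩)]
  · exact (hg b h).1 j j' hj

lemma stage_eq_iff (hg : GRIP S) {b : Fin k} {j j' : Fin m} :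
    stage S b j' = stage S b j ↔ S b j ∈ stage S b j' := by
  constructor
  · intro h; rw [h]; exact mem_stage_self b j
  · intro h
    rcases floretCond hg b j' j with h1 | h1
    · exact h1
    · exact absurd (mem_stage_self b j) (Finset.disjoint_left.1 h1 h)

lemma floret_eq (hg : GRIP S) {b : Fin k} {j : Fin m} :
    floret S b (S b j) = stage S b j := by
  ext x
  simp only [floret, Finset.mem_biUnion, Finset.mem_filter, Finset.mem_univ, true_and]
  constructor
  · rintro ⟨j', hj', hx⟩
    have : stage S b j' = stage S b j :=
      (stage_eq_iff hg).2 (hj' ▸ mem_stage_self b j')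
    rwa [← this]
  · intro hx
    exact ⟨j, rfl, hx⟩

lemma floretSum_eq (hg : GRIP S) (b : Fin k) (j : Fin m) (d : Fin m → ℝ) :
    floretSum S b (S b j) d = ∑ j', dRow S b j j' * d j' := by
  unfold floretSum dRow
  refine Finset.sum_congr rfl fun j' _ => ?_
  have : S b j' ∈ floret S b (S b j) ↔ stage S b j' = stage S b j := by
    rw [floret_eq hg, ← stage_eq_iff hg, eq_comm]
  simp [this]

lemma floretSum_pos (hg : GRIP S) (b : Fin k) (j : Fin m) (d : Fin m → ℝ) (hd : ∀ j, 0 < d j) :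
    0 < floretSum S b (S b j) d := by
  unfold floretSum
  refine Finset.sum_pos' (fun x _ => ?_) ⟨j, Finset.mem_univ _, ?_⟩
  · split_ifs
    · exact (hd x).le
    · exact le_rfl
  · rw [if_pos]
    · exact hd j
    · rw [floret_eq hg]; exact mem_stage_self b j

lemma floretSum_sum (hg : GRIP S) (b : Fin k) (j : Fin m) (d : Fin m → ℝ) :
    floretSum S b (S b j) d = ∑ i ∈ stage S b j, rowDot S b i d := by
  unfold floretSum rowDot
  rw [Finset.sum_comm]
  refine Finset.sum_congr rfl fun j' _ => ?_
  rw [floret_eq hg, Finset.sum_ite_eq]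

/-- averaging over classes -/
lemma avg (l : ℕ) (q r : Fin m → ℝ) (hq : ∀ j j', colEquiv S l j j' → q j = q j') :
    ∑ j, q j * r j = ∑ j, q j * ((colWeight S l j : ℝ)⁻¹ *
      ∑ j' ∈ univ.filter (fun j' => colEquiv S l j j'), r j') := by
  have h1 : ∀ j, q j * ((colWeight S l j : ℝ)⁻¹ *
      ∑ j' ∈ univ.filter (fun j' => colEquiv S l j j'), r j')
      = ∑ j', if colEquiv S l j' j then q j' * (colWeight S l j' : ℝ)⁻¹ * r j' else 0 := by
    intro j
    rw [← mul_assoc, Finset.mul_sum, Finset.sum_filter]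
    refine Finset.sum_congr rfl fun j' _ => ?_
    by_cases h : colEquiv S l j j'
    · rw [if_pos h, if_pos (ce_symm h), hq j j' h, cw_congr h]
    · rw [if_neg h, if_neg fun h' => h (ce_symm h')]
  simp_rw [h1]
  rw [Finset.sum_comm]
  refine Finset.sum_congr rfl fun j _ => ?_
  rw [← Finset.sum_filter, Finset.sum_const, nsmul_eq_mul]
  change _ = (colWeight S l j : ℝ) * _
  have := cw_ne (S := S) l j
  field_simp

lemma pv_congr (d : Fin m → ℝ) {l : ℕ} {j j' : Fin m} (h : colEquiv S l j j') :
    pv S d l j = pv S d l j' := by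
  unfold pv
  rw [cw_congr h]
  congr 1
  refine Finset.prod_congr rfl fun b hb => ?_
  rw [h b (Finset.mem_filter.1 hb).2]

def Inv (S : Fin k → Fin m → ℕ) (d : Fin m → ℝ) (l : ℕ) : Prop :=
  (∑ j, pv S d l j = ∑ j, d j) ∧ ∀ b : Fin k, (b : ℕ) < l → ∀ i,
    ∑ j, rowVec S b i j * pv S d l j = ∑ j, rowVec S b i j * d j

lemma Inv.span {d : Fin m → ℝ} {l : ℕ} (h : Inv S d l) (v : Fin m → ℝ)
    (hv : v ∈ Submodule.span ℝ (prefixRows S l)) :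
    ∑ j, v j * pv S d l j = ∑ j, v j * d j := by
  induction hv using Submodule.span_induction with
  | mem x hx => obtain ⟨b, i, hb, rfl⟩ := hx; exact h.2 b hb i
  | zero => simp
  | add x y _ _ hx hy => simp only [Pi.add_apply, add_mul, Finset.sum_add_distrib, hx, hy]
  | smul a x _ hx => simp only [Pi.smul_apply, smul_eq_mul, mul_assoc, ← Finset.mul_sum, hx]

lemma Inv.dRow (hg : GRIP S) {d : Fin m → ℝ} {b : Fin k} (h : Inv S d (b : ℕ)) (j0 : Fin m) :
    ∑ j, dRow S b j0 j * pv S d (b : ℕ) j = ∑ j, dRow S b j0 j * d j := by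
  rcases Nat.eq_zero_or_pos (b : ℕ) with hb | hb
  · have : ∀ j, PM.dRow S b j0 j = 1 := by
      intro j
      unfold PM.dRow
      rw [if_pos]
      apply stage_congr
      intro c hc
      omega
    simp only [this, one_mul]
    exact h.1
  · exact h.span _ ((hg b hb).2.2 j0)

lemma filter_eq {b : Fin k} {j x : Fin m} (h : colEquiv S (b : ℕ) j x) :
    (univ.filter fun j' => colEquiv S (b : ℕ) j j' ∧ S b j' = S b x).card
      = colWeight S ((b : ℕ) + 1) x := by
  unfold colWeight
  congr 1
  ext y
  simp only [Finset.mem_filter, Finset.mem_univ, true_and, ce_succ, ce_iff h, eq_comm]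

lemma main_sum (hg : GRIP S) {d : Fin m → ℝ} {b : Fin k} (h : Inv S d (b : ℕ)) (i : ℕ) (C : ℝ)
    (hC : ∀ j, S b j = i → C * (colWeight S (b : ℕ) j : ℝ) = (colWeight S ((b : ℕ) + 1) j : ℝ)) :
    ∑ j, rowVec S b i j * pv S d (b : ℕ) j = C * floretSum S b i d := by
  by_cases hi : ∃ j, S b j = i
  · obtain ⟨j0, rfl⟩ := hi
    rw [floretSum_eq hg, ← h.dRow hg, Finset.mul_sum]
    simp_rw [mul_comm (rowVec _ _ _ _)]
    rw [avg (b : ℕ) (pv S d (b : ℕ)) _ (fun j j' hj => pv_congr d hj)]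
    refine Finset.sum_congr rfl fun j _ => ?_
    unfold rowVec PM.dRow
    rw [← Finset.sum_filter, Finset.sum_const, Finset.filter_filter, nsmul_eq_mul, mul_one]
    by_cases hs : stage S b j = stage S b j0
    · rw [if_pos hs]
      have h1 := (stage_eq_iff hg).1 hs
      unfold stage at h1
      simp only [Finset.mem_image, Finset.mem_filter, Finset.mem_univ, true_and] at h1
      obtain ⟨x, hx, hx'⟩ := h1
      rw [← hx', filter_eq hx, ← hC x hx', cw_congr hx]
      have := cw_ne (S := S) (b : ℕ) x
      field_simp
    · rw [if_neg hs, Finset.card_eq_zero.2]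
      · simp
      · rw [Finset.filter_eq_empty_iff]
        rintro x - ⟨hx, hx'⟩
        apply hs
        rw [stage_eq_iff hg, ← hx', stage_congr hx]
        exact mem_stage_self b x
  · have hi' : ∀ j, S b j ≠ i := fun j hj => hi ⟨j, hj⟩
    simp [rowVec, floretSum, floret, hi']

lemma pv_succ (d : Fin m → ℝ) (b : Fin k) (j : Fin m) :
    pv S d ((b : ℕ) + 1) j = pv S d (b : ℕ) j *
      ((colWeight S (b : ℕ) j : ℝ) * (colWeight S ((b : ℕ) + 1) j : ℝ)⁻¹ *
        (rowDot S b (S b j) d / floretSum S b (S b j) d)) := by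
  have : univ.filter (fun c : Fin k => (c : ℕ) < (b : ℕ) + 1)
      = insert b (univ.filter (fun c : Fin k => (c : ℕ) < (b : ℕ))) := by
    ext c
    simp only [Finset.mem_filter, Finset.mem_univ, true_and, Finset.mem_insert, Fin.ext_iff]
    omega
  unfold pv
  rw [this, Finset.prod_insert (by simp)]
  have := cw_ne (S := S) (b : ℕ) j
  field_simp

lemma class_sum (hg : GRIP S) {d : Fin m → ℝ} (hd : ∀ j, 0 < d j) (b : Fin k) (j : Fin m) :
    ∑ j' ∈ univ.filter (fun j' => colEquiv S (b : ℕ) j j'),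
      ((colWeight S (b : ℕ) j' : ℝ) * (colWeight S ((b : ℕ) + 1) j' : ℝ)⁻¹ *
        (rowDot S b (S b j') d / floretSum S b (S b j') d)) = colWeight S (b : ℕ) j := by
  rw [← Finset.sum_fiberwise_of_maps_to (t := stage S b j) (g := S b)
    (fun x hx => Finset.mem_image_of_mem _ hx)]
  have key : ∀ i ∈ stage S b j,
      ∑ j' ∈ (univ.filter (fun j' => colEquiv S (b : ℕ) j j')).filter (fun j' => S b j' = i),
      ((colWeight S (b : ℕ) j' : ℝ) * (colWeight S ((b : ℕ) + 1) j' : ℝ)⁻¹ *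
        (rowDot S b (S b j') d / floretSum S b (S b j') d))
      = (colWeight S (b : ℕ) j : ℝ) / floretSum S b (S b j) d * rowDot S b i d := by
    intro i hi
    have h1 := hi
    unfold stage at h1
    simp only [Finset.mem_image, Finset.mem_filter, Finset.mem_univ, true_and] at h1
    obtain ⟨x, hx, rfl⟩ := h1
    rw [Finset.filter_filter, Finset.sum_congr rfl (g := fun _ =>
      (colWeight S (b : ℕ) j : ℝ) * (colWeight S ((b : ℕ) + 1) x : ℝ)⁻¹ *
        (rowDot S b (S b x) d / floretSum S b (S b j) d)), Finset.sum_const, nsmul_eq_mul,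
      filter_eq hx]
    · have := cw_ne (S := S) ((b : ℕ) + 1) x
      field_simp
    · intro y hy
      simp only [Finset.mem_filter, Finset.mem_univ, true_and] at hy
      obtain ⟨hy, hy'⟩ := hy
      rw [← cw_congr hy, hy', cw_congr (ce_succ.2 ⟨ce_trans (ce_symm hy) hx, hy'⟩)]
      have : floretSum S b (S b x) d = floretSum S b (S b j) d := by
        rw [floretSum_sum hg, floretSum_sum hg, stage_congr hx]
      rw [this]
  rw [Finset.sum_congr rfl key, ← Finset.mul_sum, ← floretSum_sum hg]
  have := (floretSum_pos hg b j d hd).ne'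
  field_simp

lemma inv_sum (hg : GRIP S) {d : Fin m → ℝ} (hd : ∀ j, 0 < d j) (b : Fin k) (f : Fin m → ℝ)
    (hf : ∀ j j', colEquiv S (b : ℕ) j j' → f j = f j') :
    ∑ j, f j * pv S d ((b : ℕ) + 1) j = ∑ j, f j * pv S d (b : ℕ) j := by
  simp_rw [pv_succ, ← mul_assoc (f _)]
  rw [avg (S := S) (b : ℕ) (fun j => f j * pv S d (b : ℕ) j) _
    (fun j j' hj => by simp only [hf j j' hj, pv_congr d hj])]
  refine Finset.sum_congr rfl fun j _ => ?_
  rw [class_sum hg hd, inv_mul_cancel₀ (cw_ne _ _), mul_one]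

lemma rowDot_eq (b : Fin k) (i : ℕ) (d : Fin m → ℝ) :
    rowDot S b i d = ∑ j, rowVec S b i j * d j := by
  simp [rowDot, rowVec]

lemma inv_all (hg : GRIP S) {d : Fin m → ℝ} (hd : ∀ j, 0 < d j) (hd1 : ∑ j, d j = 1) (l : ℕ)
    (hl : l ≤ k) : Inv S d l := by
  induction l with
  | zero =>
    refine ⟨?_, fun b hb => by omega⟩
    have hm : (m : ℝ) ≠ 0 := by
      rintro h
      have : m = 0 := by exact_mod_cast h
      subst this
      simp at hd1
    simp [pv, colWeight, colEquiv, hd1, hm]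
  | succ l ih =>
    have ih := ih (by omega)
    obtain ⟨b, rfl⟩ : ∃ b : Fin k, (b : ℕ) = l := ⟨⟨l, by omega⟩, rfl⟩
    refine ⟨?_, fun c hc i => ?_⟩
    · have := inv_sum hg hd b (fun _ => 1) (fun _ _ _ => rfl)
      simp only [one_mul] at this
      rw [this, ih.1]
    · rcases Nat.lt_succ_iff_lt_or_eq.1 hc with h1 | h1
      · rw [inv_sum hg hd b, ih.2 c h1]
        intro j j' hj
        simp only [rowVec, hj c h1]
      · have : c = b := Fin.ext h1
        subst this
        by_cases hi : ∃ j, S c j = i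
        · obtain ⟨j0, rfl⟩ := hi
          have hw : ∀ j, S c j = S c j0 → (colWeight S ((c : ℕ) + 1) j0 : ℝ) / colWeight S (c : ℕ) j0 *
              (colWeight S (c : ℕ) j : ℝ) = (colWeight S ((c : ℕ) + 1) j : ℝ) := by
            intro j hj
            have h2 : (colWeight S ((c : ℕ) + 1) j : ℝ) * colWeight S (c : ℕ) j0 =
              colWeight S ((c : ℕ) + 1) j0 * colWeight S (c : ℕ) j := by
              exact_mod_cast wellConn hg c j j0 hj
            have := cw_ne (S := S) (c : ℕ) j0
            field_simp
            linarith
          have hmain := main_sum hg ih (S c j0) _ hw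
          have hx : ∀ j, rowVec S c (S c j0) j * pv S d ((c : ℕ) + 1) j =
            (rowVec S c (S c j0) j * pv S d (c : ℕ) j) *
             ((colWeight S (c : ℕ) j0 : ℝ) / colWeight S ((c : ℕ) + 1) j0 *
              (rowDot S c (S c j0) d / floretSum S c (S c j0) d)) := by
            intro j
            by_cases hj : S c j = S c j0
            · rw [pv_succ, hj, ← hw j hj]
              have := cw_ne (S := S) (c : ℕ) j0
              have := cw_ne (S := S) (c : ℕ) j
              have := cw_ne (S := S) ((c : ℕ) + 1) j0
              field_simp
            · simp [rowVec, hj]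
          rw [Finset.sum_congr rfl fun j _ => hx j, ← Finset.sum_mul, hmain, ← rowDot_eq]
          have := cw_ne (S := S) (c : ℕ) j0
          have := cw_ne (S := S) ((c : ℕ) + 1) j0
          have := (floretSum_pos hg c j0 d hd).ne'
          field_simp
        · have hi' : ∀ j, S c j ≠ i := fun j hj => hi ⟨j, hj⟩
          simp [rowVec, hi']

end

end PM

open Finset PM in
/-- Lemma 3.16.  Let `A` (encoded by `S`) be a multipartition matrix
with `k` blocks satisfying the GRIP, `d` a normalized data vector with positive entries,
and let `L` be the last block (`L = k` in 1-indexed notation).  For a row `i` of the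
last block, let `Ck` be its connection ratio `C^k_i = c^k_j / c^{k−1}_j` (for `j` in the
support).  Then
`Σ_{j ∈ I^k_i} (1/c^{k−1}_j) ∏_{ℓ=1}^{k−1} (α^ℓ_{S(ℓ,j)}·d)/(Σ_{α^ℓ_{i′} ∈ F^ℓ[S(ℓ,j)]} α^ℓ_{i′}·d)`
`= C^k_i ⬝ Σ_{α^k_{i′} ∈ F^k[i]} α^k_{i′}·d`. -/
theorem grip_last_block_sum {k m : ℕ} (S : Fin k → Fin m → ℕ) (hgrip : GRIP S)
    (d : Fin m → ℝ) (hd : ∀ j, 0 < d j) (hd1 : (∑ j, d j) = 1)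
    (L : Fin k) (hL : (L : ℕ) = k - 1)
    (i : ℕ) (Ck : ℝ)
    (hCk : ∀ j : Fin m, S L j = i →
      Ck * (colWeight S (k - 1) j : ℝ) = (colWeight S k j : ℝ)) :
    ∑ j ∈ univ.filter (fun j : Fin m => S L j = i),
        (colWeight S (k - 1) j : ℝ)⁻¹ *
          ∏ b ∈ univ.filter (fun b : Fin k => (b : ℕ) < k - 1),
            rowDot S b (S b j) d / floretSum S b (S b j) d
      = Ck * floretSum S L i d := by
  have hk : k - 1 + 1 = k := by have := L.2; omega
  have h := main_sum hgrip (b := L) (inv_all hgrip hd hd1 (L : ℕ) (by omega)) i Ck (by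
    rw [hL, hk]; exact hCk)
  rw [← h, Finset.sum_filter]
  refine Finset.sum_congr rfl fun j _ => ?_
  simp only [rowVec, pv, hL, ite_mul, one_mul, zero_mul]
end

section
/- Let Γ be a simplicial complex on ground set {1,…,p} whose ordered list of facets F_1,…,F_k satisfies the running intersection property, and let A = A_Γ be the associated binary hierarchical multipartition matrix with blocks A^1,…,A^k. Then A satisfies the generalized running intersection property (GRIP). -/
open Finset

open Finset

/-- The binary hierarchical multipartition matrix `A_Γ` of a list of facets
`F : Fin k → Finset (Fin p)`: columns are indexed by subsets `T ⊆ {1,…,p}`, and the row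
of block `b` supported on column `T` is the subset `T ∩ F b ⊆ F b` (rows of block `b`
are indexed by subsets of `{1,…,p}`; subsets not contained in `F b` index zero rows). -/
def hierS {p k : ℕ} (F : Fin k → Finset (Fin p)) :
    Fin k → Finset (Fin p) → Finset (Fin p) :=
  fun b T => T ∩ F b

open PM in
theorem hier_colEquiv_iff {p k : ℕ} (F : Fin k → Finset (Fin p)) (l : ℕ)
    (T T' : Finset (Fin p)) : colEquiv (hierS F) l T T' ↔
      ∀ x ∈ (univ.filter fun b' : Fin k => (b' : ℕ) < l).biUnion F, (x ∈ T ↔ x ∈ T') := by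
  simp only [colEquiv, hierS, Finset.ext_iff, Finset.mem_inter, Finset.mem_biUnion,
    Finset.mem_filter, Finset.mem_univ, true_and]
  constructor
  · rintro h x ⟨b, hb, hx⟩
    have := h b hb x
    tauto
  · intro h b hb x
    have := h x
    constructor
    · rintro ⟨h1, h2⟩
      exact ⟨(this ⟨b, hb, h2⟩).1 h1, h2⟩
    · rintro ⟨h1, h2⟩
      exact ⟨(this ⟨b, hb, h2⟩).2 h1, h2⟩

open PM in
theorem hier_colWeight_le {p k : ℕ} (F : Fin k → Finset (Fin p)) (l : ℕ)
    (T T' : Finset (Fin p)) : colWeight (hierS F) l T ≤ colWeight (hierS F) l T' := by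
  unfold colWeight
  apply Finset.card_le_card_of_injOn (fun X => symmDiff X (symmDiff T T'))
  · intro X hX
    simp only [Finset.coe_filter, Finset.mem_univ, true_and, Set.mem_ofPred_eq,
      hier_colEquiv_iff] at hX ⊢
    intro x hx
    have := hX x hx
    simp only [Finset.mem_symmDiff]
    tauto
  · intro X _ Y _ h
    exact symmDiff_left_injective _ h

open PM in
theorem hier_mem_stage {p k : ℕ} (F : Fin k → Finset (Fin p)) (b : Fin k)
    (C : Finset (Fin p))
    (hC : ((univ.filter fun b' : Fin k => (b' : ℕ) < (b : ℕ)).biUnion F) ∩ F b = C)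
    (T X : Finset (Fin p)) :
    X ∈ stage (hierS F) b T ↔ X ⊆ F b ∧ X ∩ C = T ∩ C := by
  subst hC
  simp only [stage, Finset.mem_image, Finset.mem_filter, Finset.mem_univ, true_and,
    hier_colEquiv_iff]
  generalize (univ.filter fun b' : Fin k => (b' : ℕ) < (b : ℕ)).biUnion F = U
  constructor
  · rintro ⟨Y, hY, rfl⟩
    refine ⟨Finset.inter_subset_right, ?_⟩
    ext x
    have := hY x
    simp only [hierS, Finset.mem_inter]
    tauto
  · rintro ⟨h1, h2⟩
    refine ⟨X ∪ (T \ F b), ?_, ?_⟩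
    · intro x hx
      have h3 := Finset.ext_iff.1 h2 x
      have h4 := @h1 x
      simp only [Finset.mem_inter, Finset.mem_union, Finset.mem_sdiff] at *
      tauto
    · ext x
      have h4 := @h1 x
      simp only [hierS, Finset.mem_inter, Finset.mem_union, Finset.mem_sdiff] at *
      tauto

open PM in
theorem hier_stage_eq_iff {p k : ℕ} (F : Fin k → Finset (Fin p)) (b : Fin k)
    (C : Finset (Fin p))
    (hC : ((univ.filter fun b' : Fin k => (b' : ℕ) < (b : ℕ)).biUnion F) ∩ F b = C)
    (T T' : Finset (Fin p)) :
    stage (hierS F) b T = stage (hierS F) b T' ↔ T ∩ C = T' ∩ C := by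
  constructor
  · intro h
    have hCb : C ⊆ F b := hC ▸ Finset.inter_subset_right
    have h1 : T ∩ C ∈ stage (hierS F) b T := by
      rw [hier_mem_stage F b C hC]
      exact ⟨Finset.inter_subset_right.trans hCb, by simp⟩
    rw [h, hier_mem_stage F b C hC] at h1
    simpa using h1.2
  · intro h
    ext X
    rw [hier_mem_stage F b C hC, hier_mem_stage F b C hC, h]

open Finset PM in
/-- Proposition 4.1.  Let `Γ` be a simplicial complex on `{1,…,p}`
whose ordered list of facets `F_1,…,F_k` (pairwise incomparable, as facets of a
simplicial complex) satisfies the running intersection property.  Then the associated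
binary hierarchical multipartition matrix `A_Γ` satisfies the generalized running
intersection property. -/
theorem rip_implies_grip {p k : ℕ} (F : Fin k → Finset (Fin p))
    (hfacets : ∀ i j : Fin k, F i ⊆ F j → i = j)
    (hrip : ∀ b : Fin k, 0 < (b : ℕ) → ∃ s : Fin k, (s : ℕ) < (b : ℕ) ∧
      ((univ.filter fun b' : Fin k => (b' : ℕ) < (b : ℕ)).biUnion F) ∩ F b =
        F s ∩ F b) :
    GRIP (hierS F) := by
  intro b hb
  obtain ⟨s, hs, hC⟩ := hrip b hb
  refine ⟨?_, ?_, ?_⟩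
  · intro j j' _
    rw [(hier_colWeight_le F _ j j').antisymm (hier_colWeight_le F _ j' j),
      (hier_colWeight_le F b j j').antisymm (hier_colWeight_le F b j' j)]
  · intro j j'
    rw [or_iff_not_imp_right, Finset.not_disjoint_iff]
    rintro ⟨X, h1, h2⟩
    rw [hier_mem_stage F b _ hC] at h1 h2
    rw [hier_stage_eq_iff F b _ hC, ← h1.2, h2.2]
  · intro j0
    have key : dRow (hierS F) b j0 =
        ∑ i ∈ univ.filter (fun i : Finset (Fin p) => i ∩ F b = j0 ∩ (F s ∩ F b)),
          rowVec (hierS F) s i := by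
      funext T
      simp only [dRow, hier_stage_eq_iff F b _ hC, Finset.sum_apply, rowVec, hierS]
      by_cases h : T ∩ (F s ∩ F b) = j0 ∩ (F s ∩ F b)
      · rw [if_pos h, Finset.sum_eq_single (T ∩ F s)]
        · simp
        · intro c _ hc
          exact if_neg fun h' => hc h'.symm
        · intro hn
          exact absurd (by simpa [Finset.inter_assoc] using h) hn
      · rw [if_neg h, Finset.sum_eq_zero]
        intro c hc
        refine if_neg fun h' => h ?_
        subst h'
        simpa [Finset.inter_assoc] using hc
    rw [key]
    exact Submodule.sum_mem _ fun i _ => Submodule.subset_span ⟨s, i, hs, rfl⟩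
end

section
/- Let Γ be a simplicial complex on {1,…,p} with facets F_1,…,F_k, let A = A_Γ be the binary hierarchical multipartition matrix, fix 1 ≤ ℓ ≤ k − 1, and let Q = F_1 ∪ ⋯ ∪ F_ℓ. The rows of B = ∪_{n=1}^ℓ A^n are indexed by subsets T ⊆ Q, where the column of B indexed by S ⊆ {1,…,p} has a 1 in row T iff T = S ∩ Q. Then for U ⊆ F_{ℓ+1}, the row α^{ℓ+1}_U of A^{ℓ+1} is connected to the row of B indexed by T if and only if U ∩ Q = T ∩ F_{ℓ+1}. Consequently, the pair (B, A^{ℓ+1}) satisfies the floret condition. -/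
open Finset

open Finset

open Finset PM in
/-- part of the proof of Proposition 4.1.  Let `A = A_Γ` be the
binary hierarchical multipartition matrix of facets `F_1,…,F_k`, fix a block `b` with
`0 < b` and let `Q = F_1 ∪ ⋯ ∪ F_b` (union of the facets of the preceding blocks).  The
rows of `B = ∪_{n<b} A^n` are indexed by subsets `T ⊆ Q` (the row `T` being supported on
the columns `Scol` with `Scol ∩ Q = T`).  Then for `U ⊆ F_b`, the row `α^{b}_U` of block
`b` is connected to the row of `B` indexed by `T` (their supports meet, i.e. some column
`Scol` satisfies `Scol ∩ Q = T` and `Scol ∩ F b = U`) if and only if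
`U ∩ Q = T ∩ F b`.  Consequently, the pair `(B, A^{b})` satisfies the floret
condition. -/
theorem hier_connected_iff {p k : ℕ} (F : Fin k → Finset (Fin p)) (b : Fin k)
    (hb : 0 < (b : ℕ)) (Q : Finset (Fin p))
    (hQ : Q = (univ.filter fun b' : Fin k => (b' : ℕ) < (b : ℕ)).biUnion F) :
    (∀ T U : Finset (Fin p), T ⊆ Q → U ⊆ F b →
      ((∃ Scol : Finset (Fin p), Scol ∩ Q = T ∧ Scol ∩ F b = U) ↔
        U ∩ Q = T ∩ F b)) ∧
    FloretCondition (hierS F) b := by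
  have key : ∀ T U : Finset (Fin p), T ⊆ Q → U ⊆ F b →
      ((∃ Scol : Finset (Fin p), Scol ∩ Q = T ∧ Scol ∩ F b = U) ↔
        U ∩ Q = T ∩ F b) := by
    intro T U hT hU
    constructor
    · rintro ⟨C, rfl, rfl⟩
      exact inter_right_comm C (F b) Q
    · intro h
      have h' : ∀ x, (x ∈ U ∧ x ∈ Q) ↔ (x ∈ T ∧ x ∈ F b) := fun x => by
        rw [← mem_inter, ← mem_inter, h]
      refine ⟨T ∪ U, ?_, ?_⟩
      · ext x
        have h1 := h' x
        have h2 := @hT x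
        have h3 := @hU x
        simp only [mem_inter, mem_union]
        tauto
      · ext x
        have h1 := h' x
        have h2 := @hT x
        have h3 := @hU x
        simp only [mem_inter, mem_union]
        tauto
  refine ⟨key, ?_⟩
  have hcol : ∀ j j' : Finset (Fin p),
      colEquiv (hierS F) (b : ℕ) j j' ↔ j' ∩ Q = j ∩ Q := by
    intro j j'
    constructor
    · intro h
      ext x
      simp only [mem_inter, and_congr_left_iff]
      intro hx
      rw [hQ, mem_biUnion] at hx
      obtain ⟨c, hc, hxc⟩ := hx
      have h1 : j ∩ F c = j' ∩ F c := h c (mem_filter.mp hc).2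
      have h2 : x ∈ j ∩ F c ↔ x ∈ j' ∩ F c := by rw [h1]
      simp only [mem_inter] at h2
      tauto
    · intro h c hc
      change j ∩ F c = j' ∩ F c
      ext x
      simp only [mem_inter, and_congr_left_iff]
      intro hx
      have hxQ : x ∈ Q := by
        rw [hQ, mem_biUnion]
        exact ⟨c, mem_filter.mpr ⟨mem_univ _, hc⟩, hx⟩
      have h2 : x ∈ j' ∩ Q ↔ x ∈ j ∩ Q := by rw [h]
      simp only [mem_inter] at h2
      tauto
  have hst : ∀ j U : Finset (Fin p),
      U ∈ stage (hierS F) b j ↔ U ⊆ F b ∧ U ∩ Q = (j ∩ Q) ∩ F b := by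
    intro j U
    simp only [stage, mem_image, mem_filter, mem_univ, true_and, hcol]
    constructor
    · rintro ⟨C, h1, h2⟩
      have h2' : C ∩ F b = U := h2
      have hU : U ⊆ F b := h2' ▸ inter_subset_right
      exact ⟨hU, (key _ _ inter_subset_right hU).mp ⟨C, h1, h2'⟩⟩
    · rintro ⟨hU, h⟩
      exact (key _ _ inter_subset_right hU).mpr h
  intro j j'
  by_cases h : (j ∩ Q) ∩ F b = (j' ∩ Q) ∩ F b
  · left
    ext U
    rw [hst, hst, h]
  · right
    rw [disjoint_left]
    intro U h1 h2
    rw [hst] at h1 h2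
    exact h (h1.2.symm.trans h2.2)
end

section
/- Let A be a multipartition matrix with k blocks and pairwise distinct columns that is staged and balanced (equivalently, A is the matrix of a stratified, balanced staged tree). Then A is well-connected. -/
open Finset

namespace PM

variable {k : ℕ} {J : Type*} {I : Type*} [Fintype J] [DecidableEq J] [DecidableEq I]

/-- A multipartition matrix with pairwise distinct columns is *staged* if its associated
tree is a staged tree: for each level, the stages (sets of next-level rows reachable from
two columns agreeing up to that level) are equal or disjoint. -/
def Staged (S : Fin k → J → I) : Prop :=
  ∀ b : Fin k, 0 < (b : ℕ) → FloretCondition S b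

/-- The interpolating polynomial `t_ℓ(j)` of the vertex of the tree determined by the
first `ℓ` edges along the root-to-leaf path of column `j`: the sum over all columns `j'`
agreeing with `j` in the first `ℓ` blocks of the product of the variables of their
remaining edges. -/
noncomputable def interp (S : Fin k → J → I) (ℓ : ℕ) (j : J) :
    MvPolynomial (Fin k × I) ℝ :=
  ∑ j' ∈ Finset.univ.filter (fun j' => colEquiv S ℓ j j'),
    ∏ b ∈ Finset.univ.filter (fun b : Fin k => ℓ ≤ (b : ℕ)),
      MvPolynomial.X (b, S b j')

/-- A staged multipartition matrix with pairwise distinct columns is *balanced* if for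
every level `b ≥ 1`, any two vertices in the same stage (columns `j`, `j''` with equal
stages), and any matching pairs of children (columns `j₁, j₂ ∼_b j` and
`j₁'', j₂'' ∼_b j''` with `S b j₁ = S b j₁''` and `S b j₂ = S b j₂''`), one has
`t(j₁) t(j₂'') = t(j₁'') t(j₂)` as polynomials. -/
def Balanced (S : Fin k → J → I) : Prop :=
  ∀ b : Fin k, 0 < (b : ℕ) →
    ∀ j j'' : J, stage S b j = stage S b j'' →
      ∀ j₁ j₂ j₁'' j₂'' : J,
        colEquiv S (b : ℕ) j j₁ → colEquiv S (b : ℕ) j j₂ →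
        colEquiv S (b : ℕ) j'' j₁'' → colEquiv S (b : ℕ) j'' j₂'' →
        S b j₁ = S b j₁'' → S b j₂ = S b j₂'' →
        interp S ((b : ℕ) + 1) j₁ * interp S ((b : ℕ) + 1) j₂'' =
          interp S ((b : ℕ) + 1) j₁'' * interp S ((b : ℕ) + 1) j₂

end PM

namespace PM

theorem eval_interp {k m : ℕ} (S : Fin k → Fin m → ℕ) (ℓ : ℕ) (j : Fin m) :
    MvPolynomial.eval (fun _ => (1 : ℝ)) (interp S ℓ j) = (colWeight S ℓ j : ℝ) := by
  simp [interp, colWeight]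

theorem colWeight_fiber {k m : ℕ} (S : Fin k → Fin m → ℕ) (b : Fin k) (j j₂ : Fin m)
    (h : colEquiv S (b : ℕ) j j₂) :
    colWeight S ((b : ℕ) + 1) j₂ =
      ((univ.filter fun j' => colEquiv S (b : ℕ) j j').filter
        fun j' => S b j' = S b j₂).card := by
  unfold colWeight
  congr 1
  ext x
  simp only [mem_filter, mem_univ, true_and]
  constructor
  · intro hx
    exact ⟨fun c hc => (h c hc).trans (hx c (by omega)), (hx b (by omega)).symm⟩
  · rintro ⟨h1, h2⟩ c hc
    by_cases hcb : (c : ℕ) < b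
    · exact (h c hcb).symm.trans (h1 c hcb)
    · have : c = b := Fin.ext (by omega)
      subst this
      exact h2.symm

theorem colWeight_sum {k m : ℕ} (S : Fin k → Fin m → ℕ) (b : Fin k) (j : Fin m) :
    colWeight S (b : ℕ) j = ∑ i ∈ stage S b j,
      ((univ.filter fun j' => colEquiv S (b : ℕ) j j').filter fun j' => S b j' = i).card := by
  unfold colWeight stage
  exact card_eq_sum_card_image _ _

end PM

open Finset PM in
/-- Lemma 4.4.  Let `A` (encoded by `S`) be a multipartition matrix
with `k` blocks and pairwise distinct columns which is staged and balanced (equivalently,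
`A` is the matrix of a stratified, balanced staged tree).  Then `A` is
well-connected. -/
theorem balanced_well_connected {k m : ℕ} (S : Fin k → Fin m → ℕ)
    (hdist : ∀ j j' : Fin m, (∀ b : Fin k, S b j = S b j') → j = j')
    (hstaged : Staged S) (hbal : Balanced S) :
    WellConnected S := by
  intro b j j' hS
  by_cases hb : 0 < (b : ℕ)
  · have hst : stage S b j = stage S b j' := by
      rcases hstaged b hb j j' with h | h
      · exact h
      · exfalso
        refine (Finset.disjoint_left.mp h) (?_ : S b j ∈ _) ?_
        · exact mem_image.mpr ⟨j, by simp [colEquiv], rfl⟩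
        · exact mem_image.mpr ⟨j', by simp [colEquiv], hS.symm⟩
    rw [colWeight_sum S b j', colWeight_sum S b j, ← hst, mul_sum, mul_sum]
    refine sum_congr rfl fun i hi => ?_
    have hi' := hi
    rw [hst] at hi'
    obtain ⟨j₂, h2, rfl⟩ := mem_image.mp hi
    obtain ⟨j₃, h3, h23⟩ := mem_image.mp hi'
    simp only [mem_filter, mem_univ, true_and] at h2 h3
    rw [← colWeight_fiber S b j j₂ h2, ← h23, ← colWeight_fiber S b j' j₃ h3]
    have := hbal b hb j j' hst j j₂ j' j₃ (fun _ _ => rfl) h2 (fun _ _ => rfl) h3 hS h23.symm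
    have := congrArg (MvPolynomial.eval (fun _ => (1 : ℝ))) this
    simp only [map_mul, eval_interp] at this
    exact_mod_cast this
  · have e1 : colWeight S (b : ℕ) j' = colWeight S (b : ℕ) j := by
      unfold colWeight
      congr 1
      ext x
      simp only [mem_filter, mem_univ, true_and]
      constructor <;> intro _ c hc <;> omega
    have h0 : colEquiv S (b : ℕ) j j' := fun c hc => by omega
    rw [e1, colWeight_fiber S b j j' h0, colWeight_fiber S b j j (fun _ _ => rfl), hS]
end
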